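/- Let n ≥ 1 and a₁⁽¹⁾, a₂⁽¹⁾, a₁⁽²⁾, a₂⁽²⁾ ∈ ℂⁿ, and set F_i(z) = a_i⁽¹⁾·z + a_i⁽²⁾·z² for i = 1,2. Assume condition (A)₄ holds and condition (B)_{4,c} holds for some constant c ≥ 0. Then c = 4, n ≥ 4, and there exist a unitary P ∈ U(2) and a unitary Q ∈ U(n) such that, writing F(z) for the 2×n matrix with rows F₁(z), F₂(z), one has P·F(z)·Q equal for all z to the 2×n matrix with rows (√2·z, 0, z², 0, 0, …, 0) and (0, √2·z, 0, z², 0, …, 0). (That is, the curve is unitarily congruent to V₀⁽²⁾ ⊕ V₀⁽²⁾ ⊂ G(2,6).) -/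

import Mathlib

open scoped BigOperators
open Complex

noncomputable def hinner {m : ℕ} (u w : Fin m → ℂ) : ℂ :=
  ∑ i, u i * (starRingEnd ℂ) (w i)

noncomputable def gram {m k : ℕ} (v : Fin k → Fin m → ℂ) : ℂ :=
  Matrix.det (Matrix.of fun i j : Fin k => hinner (v i) (v j))

noncomputable def vOne {n : ℕ} (F : ℂ → Fin n → ℂ) (z : ℂ) : Fin (n + 2) → ℂ :=
  Fin.cons 1 (Fin.cons 0 (F z))

noncomputable def vTwo {n : ℕ} (F : ℂ → Fin n → ℂ) (z : ℂ) : Fin (n + 2) → ℂ :=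
  Fin.cons 0 (Fin.cons 1 (F z))

def IsPolyMap {n : ℕ} (F : ℂ → Fin n → ℂ) : Prop :=
  ∀ i : Fin n, ∃ p : Polynomial ℂ, ∀ z : ℂ, F z i = Polynomial.eval z p

def CondA {n : ℕ} (d : ℕ) (F₁ F₂ : ℂ → Fin n → ℂ) : Prop :=
  ∀ z : ℂ,
    1 + hinner (F₁ z) (F₁ z) + hinner (F₂ z) (F₂ z) +
      (hinner (F₁ z) (F₁ z) * hinner (F₂ z) (F₂ z) -
        hinner (F₁ z) (F₂ z) * (starRingEnd ℂ) (hinner (F₁ z) (F₂ z))) =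
    (1 + (Complex.normSq z : ℂ)) ^ d

def CondB {n : ℕ} (d : ℕ) (c : ℝ) (F₁ F₂ : ℂ → Fin n → ℂ) : Prop :=
  ∀ z : ℂ,
    gram ![vOne F₁ z, vTwo F₂ z, deriv (vOne F₁) z, deriv (vTwo F₂) z] =
      (c : ℂ) * (1 + (Complex.normSq z : ℂ)) ^ (2 * d - 4)

noncomputable def F1t (t : ℝ) (z : ℂ) : Fin 4 → ℂ :=
  ![(|t - 2| : ℝ) * z ^ 3, (Real.sqrt t : ℝ) * z,
    ((Real.sqrt ((3 - t) / (4 - t)) * |t - 2| : ℝ)) * z ^ 2,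
    ((Real.sqrt (t / (4 - t)) : ℝ)) * z ^ 2]

noncomputable def F2t (t : ℝ) (z : ℂ) : Fin 4 → ℂ :=
  ![(Real.sqrt (3 - t) : ℝ) * z ^ 2, 0, (Real.sqrt (4 - t) : ℝ) * z, 0]

noncomputable def v1t (t : ℝ) (z : ℂ) : Fin 6 → ℂ := vOne (F1t t) z

noncomputable def v2t (t : ℝ) (z : ℂ) : Fin 6 → ℂ := vTwo (F2t t) z


lemma hinner_add_left {m : ℕ} (u v w : Fin m → ℂ) : hinner (u + v) w = hinner u w + hinner v w := by
  simp [hinner, add_mul, Finset.sum_add_distrib]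

lemma hinner_add_right {m : ℕ} (u v w : Fin m → ℂ) : hinner u (v + w) = hinner u v + hinner u w := by
  simp [hinner, mul_add, Finset.sum_add_distrib]

lemma hinner_smul_left {m : ℕ} (s : ℂ) (u w : Fin m → ℂ) : hinner (s • u) w = s * hinner u w := by
  simp [hinner, Finset.mul_sum, mul_assoc]

lemma hinner_smul_right {m : ℕ} (s : ℂ) (u w : Fin m → ℂ) :
    hinner u (s • w) = (starRingEnd ℂ) s * hinner u w := by
  simp only [hinner, Finset.mul_sum, Pi.smul_apply, smul_eq_mul, map_mul]
  exact Finset.sum_congr rfl fun i _ => by ring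

lemma hinner_conj {m : ℕ} (u w : Fin m → ℂ) : (starRingEnd ℂ) (hinner u w) = hinner w u := by
  simp [hinner, mul_comm]

lemma hinner_cons {m : ℕ} (x y : ℂ) (u w : Fin m → ℂ) :
    hinner (Fin.cons x u : Fin (m+1) → ℂ) (Fin.cons y w) = x * (starRingEnd ℂ) y + hinner u w := by
  simp [hinner, Fin.sum_univ_succ]

lemma hinner_self {m : ℕ} (u : Fin m → ℂ) : ∃ x : ℝ, hinner u u = x := by
  refine ⟨∑ i, normSq (u i), ?_⟩
  simp [hinner, Complex.mul_conj]

lemma harm (α1 α2 α3 α4 β1 β2 β3 δ1 δ2 δ3 γ γ' : ℂ)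
    (h : ∀ z : ℂ, 1 + α1 * (z * (starRingEnd ℂ) z) + α2 * (z * (starRingEnd ℂ) z)^2
      + α3 * (z * (starRingEnd ℂ) z)^3 + α4 * (z * (starRingEnd ℂ) z)^4
      + (β1 * (z * (starRingEnd ℂ) z) + β2 * (z * (starRingEnd ℂ) z)^2
        + β3 * (z * (starRingEnd ℂ) z)^3) * z
      + (δ1 * (z * (starRingEnd ℂ) z) + δ2 * (z * (starRingEnd ℂ) z)^2
        + δ3 * (z * (starRingEnd ℂ) z)^3) * (starRingEnd ℂ) z
      + γ * (z * (starRingEnd ℂ) z)^2 * z^2 + γ' * (z * (starRingEnd ℂ) z)^2 * ((starRingEnd ℂ) z)^2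
      = (1 + z * (starRingEnd ℂ) z)^4) :
    α1 = 4 ∧ α2 = 6 ∧ α3 = 4 ∧ α4 = 1 ∧ β1 = 0 := by
  have key : ∀ t : ℝ, (α1 * (t:ℂ)^2 + α2 * (t:ℂ)^4 + α3 * (t:ℂ)^6 + α4 * (t:ℂ)^8
      = (1 + (t:ℂ)^2)^4 - 1) ∧ (β1 * (t:ℂ)^3 + β2 * (t:ℂ)^5 + β3 * (t:ℂ)^7 = 0) := by
    intro t
    have h1 := h t
    have h2 := h (-t)
    have h3 := h (I * t)
    have h4 := h (-(I * t))
    simp only [map_neg, map_mul, conj_I, conj_ofReal] at h1 h2 h3 h4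
    have e : (I * t) * (-I * t) = (t:ℂ)^2 := by linear_combination (-(t:ℂ)^2) * I_sq
    have e' : (-(I * t)) * (-(-I * t)) = (t:ℂ)^2 := by linear_combination (-(t:ℂ)^2) * I_sq
    have e2 : (I * t : ℂ)^2 = -(t:ℂ)^2 := by linear_combination ((t:ℂ)^2) * I_sq
    rw [e] at h3
    rw [e'] at h4
    have hI : I * I = -1 := I_mul_I
    constructor
    · linear_combination (h1 + h2 + h3 + h4) / 4 - (γ+γ') * (t:ℂ)^6 / 2 * hI
    · linear_combination (h1 - h2) / 4 - I * (h3 - h4) / 4 + ((β1 * (t:ℂ)^3 + β2 * (t:ℂ)^5 + β3 * (t:ℂ)^7) - (δ1 * (t:ℂ)^3 + δ2 * (t:ℂ)^5 + δ3 * (t:ℂ)^7)) / 2 * hI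
  obtain ⟨a1, b1⟩ := key 1
  obtain ⟨a2, b2⟩ := key 2
  obtain ⟨a3, b3⟩ := key 3
  obtain ⟨a4, b4⟩ := key 4
  push_cast at a1 a2 a3 a4 b1 b2 b3 b4
  norm_num at a1 a2 a3 a4 b1 b2 b3 b4
  refine ⟨?_, ?_, ?_, ?_, ?_⟩ <;> grind

lemma coeff_two (p q : Polynomial ℂ) : (p * q).coeff 2 =
    p.coeff 0 * q.coeff 2 + p.coeff 1 * q.coeff 1 + p.coeff 2 * q.coeff 0 := by
  rw [Polynomial.coeff_mul]
  simp [Finset.Nat.sum_antidiagonal_eq_sum_range_succ_mk, Finset.sum_range_succ]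

lemma det4 {R : Type*} [CommRing R] (A : Matrix (Fin 4) (Fin 4) R) : A.det =
    (A 0 0 * A 1 1 - A 0 1 * A 1 0) * (A 2 2 * A 3 3 - A 2 3 * A 3 2)
    - (A 0 0 * A 1 2 - A 0 2 * A 1 0) * (A 2 1 * A 3 3 - A 2 3 * A 3 1)
    + (A 0 0 * A 1 3 - A 0 3 * A 1 0) * (A 2 1 * A 3 2 - A 2 2 * A 3 1)
    + (A 0 1 * A 1 2 - A 0 2 * A 1 1) * (A 2 0 * A 3 3 - A 2 3 * A 3 0)
    - (A 0 1 * A 1 3 - A 0 3 * A 1 1) * (A 2 0 * A 3 2 - A 2 2 * A 3 0)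
    + (A 0 2 * A 1 3 - A 0 3 * A 1 2) * (A 2 0 * A 3 1 - A 2 1 * A 3 0) := by
  rw [Matrix.det_succ_row_zero]
  simp only [Fin.sum_univ_four, Matrix.det_fin_three, Matrix.submatrix_apply]
  have s0 : ∀ k : Fin 3, (0 : Fin 4).succAbove k = k.succ := by decide
  have f0 : (Fin.succ 0 : Fin 4) = 1 := rfl
  have f1 : (Fin.succ 1 : Fin 4) = 2 := rfl
  have f2 : (Fin.succ 2 : Fin 4) = 3 := rfl
  have s10 : (1 : Fin 4).succAbove 0 = 0 := rfl
  have s11 : (1 : Fin 4).succAbove 1 = 2 := rfl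
  have s12 : (1 : Fin 4).succAbove 2 = 3 := rfl
  have s20 : (2 : Fin 4).succAbove 0 = 0 := rfl
  have s21 : (2 : Fin 4).succAbove 1 = 1 := rfl
  have s22 : (2 : Fin 4).succAbove 2 = 3 := rfl
  have s30 : (3 : Fin 4).succAbove 0 = 0 := rfl
  have s31 : (3 : Fin 4).succAbove 1 = 1 := rfl
  have s32 : (3 : Fin 4).succAbove 2 = 2 := rfl
  have v0 : ((0 : Fin 4) : ℕ) = 0 := rfl
  have v1 : ((1 : Fin 4) : ℕ) = 1 := rfl
  have v2 : ((2 : Fin 4) : ℕ) = 2 := rfl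
  have v3 : ((3 : Fin 4) : ℕ) = 3 := rfl
  simp only [s0, f0, f1, f2, s10, s11, s12, s20, s21, s22, s30, s31, s32, v0, v1, v2, v3]
  ring

lemma deriv_vOne {n : ℕ} (a p : Fin n → ℂ) (z : ℂ) :
    deriv (vOne (fun z => z • a + z ^ 2 • p)) z = Fin.cons 0 (Fin.cons 0 (a + (2 * z) • p)) := by
  apply HasDerivAt.deriv
  rw [hasDerivAt_pi]
  intro i
  refine Fin.cases ?_ (fun i => ?_) i
  · simpa [vOne] using hasDerivAt_const z (1:ℂ)
  · refine Fin.cases ?_ (fun i => ?_) i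
    · simpa [vOne] using hasDerivAt_const z (0:ℂ)
    · have := ((hasDerivAt_id z).mul_const (a i)).fun_add (((hasDerivAt_id z).pow 2).mul_const (p i))
      simpa [vOne] using this

lemma deriv_vTwo {n : ℕ} (a p : Fin n → ℂ) (z : ℂ) :
    deriv (vTwo (fun z => z • a + z ^ 2 • p)) z = Fin.cons 0 (Fin.cons 0 (a + (2 * z) • p)) := by
  apply HasDerivAt.deriv
  rw [hasDerivAt_pi]
  intro i
  refine Fin.cases ?_ (fun i => ?_) i
  · simpa [vTwo] using hasDerivAt_const z (0:ℂ)
  · refine Fin.cases ?_ (fun i => ?_) i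
    · simpa [vTwo] using hasDerivAt_const z (1:ℂ)
    · have := ((hasDerivAt_id z).mul_const (a i)).fun_add (((hasDerivAt_id z).pow 2).mul_const (p i))
      simpa [vTwo] using this

lemma condA_data {n : ℕ} (a b p q : Fin n → ℂ)
    (hA : CondA 4 (fun z => z • a + z ^ 2 • p) (fun z => z • b + z ^ 2 • q)) :
    hinner a a + hinner b b = 4 ∧
    hinner p p + hinner q q + (hinner a a * hinner b b - hinner a b * hinner b a) = 6 ∧
    hinner a a * hinner q q + hinner b b * hinner p p - hinner a b * hinner q p
      - hinner b a * hinner p q + hinner a p * hinner q b + hinner b q * hinner p a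
      - hinner a q * hinner q a - hinner b p * hinner p b = 4 ∧
    hinner p p * hinner q q - hinner p q * hinner q p = 1 ∧
    hinner p a + hinner q b = 0 := by
  apply harm _ _ _ _ _
    (hinner a a * hinner q b + hinner p a * hinner b b - hinner a b * hinner q a
      - hinner p b * hinner b a)
    (hinner p p * hinner q b + hinner p a * hinner q q - hinner p q * hinner q a
      - hinner p b * hinner q p)
    (hinner a p + hinner b q)
    (hinner a a * hinner b q + hinner a p * hinner b b - hinner a b * hinner b p
      - hinner a q * hinner b a)
    (hinner p p * hinner b q + hinner a p * hinner q q - hinner p q * hinner b p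
      - hinner a q * hinner q p)
    (hinner p a * hinner q b - hinner p b * hinner q a)
    (hinner a p * hinner b q - hinner a q * hinner b p)
  intro z
  have h := hA z
  simp only [hinner_conj, hinner_add_left, hinner_add_right, hinner_smul_left,
    hinner_smul_right, map_pow, map_add, map_mul, Complex.conj_conj, ← Complex.mul_conj] at h
  linear_combination h

open Polynomial in
lemma polyB (M N C D : Fin 2 → Fin 2 → ℂ) (c w v : ℂ) (hv : w * v = 1)
    (h : ∀ t : ℝ, Matrix.det (Matrix.of ![
      ![1 + (t:ℂ)^2 * M 0 0 + (t:ℂ)^3 * (v * C 0 0 + w * D 0 0) + (t:ℂ)^4 * N 0 0,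
        (t:ℂ)^2 * M 0 1 + (t:ℂ)^3 * (v * C 0 1 + w * D 0 1) + (t:ℂ)^4 * N 0 1,
        (t:ℂ) * (w * M 0 0) + (t:ℂ)^2 * (2 * C 0 0 + w^2 * D 0 0) + (t:ℂ)^3 * (2 * w * N 0 0),
        (t:ℂ) * (w * M 0 1) + (t:ℂ)^2 * (2 * C 0 1 + w^2 * D 0 1) + (t:ℂ)^3 * (2 * w * N 0 1)],
      ![(t:ℂ)^2 * M 1 0 + (t:ℂ)^3 * (v * C 1 0 + w * D 1 0) + (t:ℂ)^4 * N 1 0,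
        1 + (t:ℂ)^2 * M 1 1 + (t:ℂ)^3 * (v * C 1 1 + w * D 1 1) + (t:ℂ)^4 * N 1 1,
        (t:ℂ) * (w * M 1 0) + (t:ℂ)^2 * (2 * C 1 0 + w^2 * D 1 0) + (t:ℂ)^3 * (2 * w * N 1 0),
        (t:ℂ) * (w * M 1 1) + (t:ℂ)^2 * (2 * C 1 1 + w^2 * D 1 1) + (t:ℂ)^3 * (2 * w * N 1 1)],
      ![(t:ℂ) * (v * M 0 0) + (t:ℂ)^2 * (v^2 * C 0 0 + 2 * D 0 0) + (t:ℂ)^3 * (2 * v * N 0 0),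
        (t:ℂ) * (v * M 0 1) + (t:ℂ)^2 * (v^2 * C 0 1 + 2 * D 0 1) + (t:ℂ)^3 * (2 * v * N 0 1),
        M 0 0 + (t:ℂ) * (2 * v * C 0 0 + 2 * w * D 0 0) + (t:ℂ)^2 * (4 * N 0 0),
        M 0 1 + (t:ℂ) * (2 * v * C 0 1 + 2 * w * D 0 1) + (t:ℂ)^2 * (4 * N 0 1)],
      ![(t:ℂ) * (v * M 1 0) + (t:ℂ)^2 * (v^2 * C 1 0 + 2 * D 1 0) + (t:ℂ)^3 * (2 * v * N 1 0),
        (t:ℂ) * (v * M 1 1) + (t:ℂ)^2 * (v^2 * C 1 1 + 2 * D 1 1) + (t:ℂ)^3 * (2 * v * N 1 1),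
        M 1 0 + (t:ℂ) * (2 * v * C 1 0 + 2 * w * D 1 0) + (t:ℂ)^2 * (4 * N 1 0),
        M 1 1 + (t:ℂ) * (2 * v * C 1 1 + 2 * w * D 1 1) + (t:ℂ)^2 * (4 * N 1 1)]]) =
      c * (1 + (t:ℂ)^2)^4) :
    M 0 0 * M 1 1 - M 0 1 * M 1 0 = c ∧
    M 0 0 * N 1 1 + M 1 1 * N 0 0 - M 0 1 * N 1 0 - M 1 0 * N 0 1
     + (v * C 0 0 + w * D 0 0) * (v * C 1 1 + w * D 1 1)
     - (v * C 0 1 + w * D 0 1) * (v * C 1 0 + w * D 1 0) = c := by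
  let L : ℂ → ℂ → ℂ → ℂ → ℂ → ℂ[X] := fun x0 x1 x2 x3 x4 =>
    Polynomial.C x0 + X * Polynomial.C x1 + X^2 * Polynomial.C x2 + X^3 * Polynomial.C x3 + X^4 * Polynomial.C x4
  have Le : ∀ x0 x1 x2 x3 x4 (t:ℂ), (L x0 x1 x2 x3 x4).eval t = x0 + t * x1 + t^2*x2+t^3*x3+t^4*x4 := by
    intros; simp [L]; ring
  have L0 : ∀ x0 x1 x2 x3 x4, (L x0 x1 x2 x3 x4).coeff 0 = x0 := by
    intros; simp [L]
  have L1 : ∀ x0 x1 x2 x3 x4, (L x0 x1 x2 x3 x4).coeff 1 = x1 := by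
    intros; simp only [L, mul_comm X _]; simp [coeff_C, coeff_X, coeff_X_pow]
  have L2 : ∀ x0 x1 x2 x3 x4, (L x0 x1 x2 x3 x4).coeff 2 = x2 := by
    intros; simp only [L, mul_comm X _]; simp [coeff_C, coeff_X, coeff_X_pow]
  let A : Matrix (Fin 4) (Fin 4) ℂ[X] := Matrix.of ![
      ![L 1 0 (M 0 0) (v * C 0 0 + w * D 0 0) (N 0 0),
        L 0 0 (M 0 1) (v * C 0 1 + w * D 0 1) (N 0 1),
        L 0 (w * M 0 0) (2 * C 0 0 + w^2 * D 0 0) (2 * w * N 0 0) 0,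
        L 0 (w * M 0 1) (2 * C 0 1 + w^2 * D 0 1) (2 * w * N 0 1) 0],
      ![L 0 0 (M 1 0) (v * C 1 0 + w * D 1 0) (N 1 0),
        L 1 0 (M 1 1) (v * C 1 1 + w * D 1 1) (N 1 1),
        L 0 (w * M 1 0) (2 * C 1 0 + w^2 * D 1 0) (2 * w * N 1 0) 0,
        L 0 (w * M 1 1) (2 * C 1 1 + w^2 * D 1 1) (2 * w * N 1 1) 0],
      ![L 0 (v * M 0 0) (v^2 * C 0 0 + 2 * D 0 0) (2 * v * N 0 0) 0,
        L 0 (v * M 0 1) (v^2 * C 0 1 + 2 * D 0 1) (2 * v * N 0 1) 0,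
        L (M 0 0) (2 * v * C 0 0 + 2 * w * D 0 0) (4 * N 0 0) 0 0,
        L (M 0 1) (2 * v * C 0 1 + 2 * w * D 0 1) (4 * N 0 1) 0 0],
      ![L 0 (v * M 1 0) (v^2 * C 1 0 + 2 * D 1 0) (2 * v * N 1 0) 0,
        L 0 (v * M 1 1) (v^2 * C 1 1 + 2 * D 1 1) (2 * v * N 1 1) 0,
        L (M 1 0) (2 * v * C 1 0 + 2 * w * D 1 0) (4 * N 1 0) 0 0,
        L (M 1 1) (2 * v * C 1 1 + 2 * w * D 1 1) (4 * N 1 1) 0 0]]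
  have hP : A.det = Polynomial.C c * (1 + X^2)^4 := by
    apply Polynomial.eq_of_infinite_eval_eq
    refine Set.Infinite.mono ?_ (Set.infinite_range_of_injective Complex.ofReal_injective)
    rintro _ ⟨t, rfl⟩
    have h1 := h t
    show eval (t:ℂ) _ = eval (t:ℂ) _
    simp only [eval_mul, eval_C, eval_pow, eval_add, eval_one, eval_X]
    rw [← h1, ← Polynomial.coe_evalRingHom, RingHom.map_det]
    congr 1
    ext i j
    fin_cases i <;> fin_cases j <;> simp [A, Le]
  rw [det4] at hP
  have e0 := congrArg (fun p => coeff p 0) hP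
  have e2 := congrArg (fun p => coeff p 2) hP
  have r0 : (Polynomial.C c * (1 + X^2)^4).coeff 0 = c := by simp [mul_coeff_zero, coeff_zero_eq_eval_zero]
  have r2 : (Polynomial.C c * (1 + X^2)^4).coeff 2 = 4 * c := by
    have : (Polynomial.C c * (1 + X^2)^4) = Polynomial.C c + X^2 * Polynomial.C (4*c)
       + X^3 * (X * Polynomial.C (6 * c) + X^3 * Polynomial.C (4*c) + X^5 * Polynomial.C c) := by
      simp only [map_mul, map_ofNat]; ring
    rw [this]
    simp [coeff_X_pow_mul', coeff_C]
  simp only [r0, r2] at e0 e2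
  simp [A, L0, L1, L2, coeff_two, mul_coeff_zero, mul_coeff_one] at e0 e2
  refine ⟨e0, ?_⟩
  linear_combination e2 / 4 + (M 0 0 * M 1 1 ^2 + M 0 0 ^2 * M 1 1 - M 0 0 * M 0 1 * M 1 0 - M 1 1 * M 0 1 * M 1 0) / 4 * hv

lemma condB_data {n : ℕ} (a b p q : Fin n → ℂ) (c : ℝ)
    (hB : CondB 4 c (fun z => z • a + z ^ 2 • p) (fun z => z • b + z ^ 2 • q))
    (w : ℂ) (hv : w * (starRingEnd ℂ) w = 1) :
    hinner a a * hinner b b - hinner a b * hinner b a = c ∧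
    hinner a a * hinner q q + hinner b b * hinner p p - hinner a b * hinner q p
      - hinner b a * hinner p q
     + ((starRingEnd ℂ) w * hinner a p + w * hinner p a) * ((starRingEnd ℂ) w * hinner b q + w * hinner q b)
     - ((starRingEnd ℂ) w * hinner a q + w * hinner p b) * ((starRingEnd ℂ) w * hinner b p + w * hinner q a) = c := by
  have := polyB (fun i j => hinner (![a, b] i) (![a, b] j)) (fun i j => hinner (![p, q] i) (![p, q] j))
    (fun i j => hinner (![a, b] i) (![p, q] j)) (fun i j => hinner (![p, q] i) (![a, b] j)) c w
    ((starRingEnd ℂ) w) hv ?_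
  · simpa using this
  intro t
  have h := hB (t * w)
  have e : (1 + (normSq (t * w) : ℂ)) = 1 + (t:ℂ)^2 := by
    rw [← Complex.mul_conj, map_mul, conj_ofReal]
    linear_combination (t:ℂ)^2 * hv
  rw [e] at h
  norm_num at h
  rw [← h, gram]
  have l1 : ∀ a b p q : Fin n → ℂ, hinner ((t * w) • a + (t*w)^2 • p) ((t * w) • b + (t*w)^2 • q) =
      (t:ℂ)^2 * hinner a b + (t:ℂ)^3 * ((starRingEnd ℂ) w * hinner a q + w * hinner p b)
      + (t:ℂ)^4 * hinner p q := by
    intro a b p q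
    simp only [hinner_add_left, hinner_add_right, hinner_smul_left,
      hinner_smul_right, map_pow, map_mul, conj_ofReal]
    linear_combination ((t:ℂ)^2 * hinner a b + (t:ℂ)^3 * ((starRingEnd ℂ) w * hinner a q + w * hinner p b)
      + (t:ℂ)^4 * hinner p q * (1 + w * (starRingEnd ℂ) w)) * hv
  have l2 : ∀ a b p q : Fin n → ℂ, hinner ((t * w) • a + (t*w)^2 • p) (b + (2 * (t*w)) • q) =
      (t:ℂ) * (w * hinner a b) + (t:ℂ)^2 * (2 * hinner a q + w^2 * hinner p b)
      + (t:ℂ)^3 * (2 * w * hinner p q) := by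
    intro a b p q
    simp only [hinner_add_left, hinner_add_right, hinner_smul_left,
      hinner_smul_right, map_pow, map_mul, conj_ofReal, map_ofNat]
    linear_combination (2 * (t:ℂ)^2 * hinner a q + 2 * w * (t:ℂ)^3 * hinner p q) * hv
  have l3 : ∀ a b p q : Fin n → ℂ, hinner (a + (2 * (t*w)) • p) ((t * w) • b + (t*w)^2 • q) =
      (t:ℂ) * ((starRingEnd ℂ) w * hinner a b) + (t:ℂ)^2 * (((starRingEnd ℂ) w)^2 * hinner a q + 2 * hinner p b)
      + (t:ℂ)^3 * (2 * (starRingEnd ℂ) w * hinner p q) := by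
    intro a b p q
    simp only [hinner_add_left, hinner_add_right, hinner_smul_left,
      hinner_smul_right, map_pow, map_mul, conj_ofReal, map_ofNat]
    linear_combination (2 * (t:ℂ)^2 * hinner p b + 2 * (starRingEnd ℂ) w * (t:ℂ)^3 * hinner p q) * hv
  have l4 : ∀ a b p q : Fin n → ℂ, hinner (a + (2 * (t*w)) • p) (b + (2 * (t*w)) • q) =
      hinner a b + (t:ℂ) * (2 * (starRingEnd ℂ) w * hinner a q + 2 * w * hinner p b)
      + (t:ℂ)^2 * (4 * hinner p q) := by
    intro a b p q
    simp only [hinner_add_left, hinner_add_right, hinner_smul_left,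
      hinner_smul_right, map_pow, map_mul, conj_ofReal, map_ofNat]
    linear_combination (4 * (t:ℂ)^2 * hinner p q) * hv
  congr 1
  ext i j
  rw [deriv_vOne, deriv_vTwo]
  simp only [vOne, vTwo]
  fin_cases i <;> fin_cases j <;>
    simp [hinner_cons, l1, l2, l3, l4, -mul_pow, -smul_add] <;> ring

lemma hinner_self_nonneg {m : ℕ} (u : Fin m → ℂ) : ∃ x : ℝ, hinner u u = x := hinner_self u

lemma herm {m : ℕ} (u w : Fin m → ℂ) (s : ℝ) (h1 : hinner u u + hinner w w = 2 * s)
    (h2 : hinner u u * hinner w w - hinner u w * hinner w u = s^2) :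
    hinner u u = s ∧ hinner w w = s ∧ hinner u w = 0 := by
  obtain ⟨x, hx⟩ := hinner_self u
  obtain ⟨y, hy⟩ := hinner_self w
  rw [← hinner_conj u w, Complex.mul_conj] at h2
  rw [hx, hy] at h1 h2
  norm_cast at h1 h2
  have hn := normSq_nonneg (hinner u w)
  have hy' : y = 2 * s - x := by linarith
  subst hy'
  have h3 : (x - s)^2 = 0 := by nlinarith [sq_nonneg (x - s)]
  have h4 : x = s := by
    have := pow_eq_zero_iff (two_ne_zero) |>.1 h3
    linarith
  subst h4
  have h5 : normSq (hinner u w) = 0 := by nlinarith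
  refine ⟨hx, ?_, normSq_eq_zero.1 h5⟩
  rw [hy]; push_cast; ring

lemma all_data {n : ℕ} (a b p q : Fin n → ℂ) (c : ℝ)
    (hA : CondA 4 (fun z => z • a + z ^ 2 • p) (fun z => z • b + z ^ 2 • q))
    (hB : CondB 4 c (fun z => z • a + z ^ 2 • p) (fun z => z • b + z ^ 2 • q)) :
    c = 4 ∧ hinner a a = 2 ∧ hinner b b = 2 ∧ hinner a b = 0 ∧
      hinner p p = 1 ∧ hinner q q = 1 ∧ hinner p q = 0 ∧
      hinner a p = 0 ∧ hinner a q = 0 ∧ hinner b p = 0 ∧ hinner b q = 0 := by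
  obtain ⟨A1, A2, A3, A4, A5⟩ := condA_data a b p q hA
  obtain ⟨B1, B2⟩ := condB_data a b p q c hB 1 (by simp)
  obtain ⟨-, B3⟩ := condB_data a b p q c hB I (by simp)
  simp only [map_one, conj_I] at B2 B3
  have hc : (c : ℂ) = 4 := by
    linear_combination -(B2 + B3) / 2 + A3 + ((hinner a p - hinner p a) * (hinner b q - hinner q b) - (hinner a q - hinner p b) * (hinner b p - hinner q a)) / 2 * I_mul_I
  obtain ⟨m1, m2, m3⟩ := herm a b 2 (by push_cast; rw [A1]; norm_num) (by rw [B1, hc]; norm_num)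
  push_cast at m1 m2
  obtain ⟨n1, n2, n3⟩ := herm p q 1 (by push_cast; linear_combination A2 - B1 - hc) (by rw [A4]; norm_num)
  push_cast at n1 n2
  refine ⟨by exact_mod_cast hc, m1, m2, m3, n1, n2, n3, ?_⟩
  have m3' : hinner b a = 0 := by rw [← hinner_conj, m3, map_zero]
  have hqb : hinner q b = - hinner p a := by linear_combination A5
  have hbq : hinner b q = - hinner a p := by
    rw [← hinner_conj, hqb, map_neg, hinner_conj]
  rw [m1, m2, m3, m3', n1, n2, n3, hqb, hbq, ← hinner_conj a p, ← hinner_conj a q, ← hinner_conj b p] at A3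
  have h : (2 * normSq (hinner a p) + normSq (hinner a q) + normSq (hinner b p) : ℂ) = 0 := by
    rw [← Complex.mul_conj, ← Complex.mul_conj, ← Complex.mul_conj]
    linear_combination -A3
  norm_cast at h
  have h1 := normSq_nonneg (hinner a p)
  have h2 := normSq_nonneg (hinner a q)
  have h3 := normSq_nonneg (hinner b p)
  have h4 : hinner a p = 0 := normSq_eq_zero.1 (by linarith)
  refine ⟨h4, normSq_eq_zero.1 (by linarith), normSq_eq_zero.1 (by linarith), ?_⟩
  rw [hbq, h4, neg_zero]

lemma inner_hinner {n : ℕ} (x y : EuclideanSpace ℂ (Fin n)) :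
    inner ℂ x y = hinner (WithLp.ofLp y) (WithLp.ofLp x) := by
  rfl

lemma extend {n : ℕ} (e : Fin 4 → Fin n → ℂ)
    (he : ∀ i j, hinner (e i) (e j) = if i = j then 1 else 0) :
    4 ≤ n ∧ ∃ b : Fin n → Fin n → ℂ, (∀ i j, hinner (b i) (b j) = if i = j then 1 else 0) ∧
      ∀ (i : Fin 4) (j : Fin n), hinner (e i) (b j) = if (j : ℕ) = i then 1 else 0 := by
  have ho : Orthonormal ℂ (fun i => WithLp.toLp 2 (e i) : Fin 4 → EuclideanSpace ℂ (Fin n)) := by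
    rw [orthonormal_iff_ite]
    intro i j
    rw [inner_hinner, he]
    simp [eq_comm]
  have hn : 4 ≤ n := by
    simpa using ho.linearIndependent.fintype_card_le_finrank
  refine ⟨hn, ?_⟩
  let v : Fin n → EuclideanSpace ℂ (Fin n) := fun j =>
    if h : (j : ℕ) < 4 then WithLp.toLp 2 (e ⟨j, h⟩) else 0
  have hs : Orthonormal ℂ (Set.domRestrict {j : Fin n | (j : ℕ) < 4} v) := by
    rw [orthonormal_iff_ite]
    rintro ⟨i, hi⟩ ⟨j, hj⟩
    have hi' : (i : ℕ) < 4 := hi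
    have hj' : (j : ℕ) < 4 := hj
    simp only [Set.domRestrict_apply, v, hi', hj', dite_true, inner_hinner, he]
    simp [Fin.ext_iff, eq_comm]
  obtain ⟨b, hb⟩ := hs.exists_orthonormalBasis_extension_of_card_eq (by simp)
  have hbb : ∀ i j, hinner (b i).ofLp (b j).ofLp = if i = j then 1 else 0 := by
    intro i j
    rw [← inner_hinner, orthonormal_iff_ite.1 b.orthonormal]
    simp [eq_comm]
  refine ⟨fun j => (b j).ofLp, hbb, ?_⟩
  intro i j
  have h1 := hb (Fin.castLE hn i) (by simp)
  have h2 : e i = (b (Fin.castLE hn i)).ofLp := by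
    rw [h1]; simp [v]
  rw [h2, hbb]
  simp [Fin.ext_iff, eq_comm]

theorem stmt5 (n : ℕ) (hn : 1 ≤ n) (a11 a21 a12 a22 : Fin n → ℂ) (c : ℝ) (hc : 0 ≤ c)
    (hA : CondA 4 (fun z => z • a11 + z ^ 2 • a12) (fun z => z • a21 + z ^ 2 • a22))
    (hB : CondB 4 c (fun z => z • a11 + z ^ 2 • a12) (fun z => z • a21 + z ^ 2 • a22)) :
    c = 4 ∧ 4 ≤ n ∧
      ∃ P : Matrix (Fin 2) (Fin 2) ℂ, P ∈ Matrix.unitaryGroup (Fin 2) ℂ ∧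
      ∃ Q : Matrix (Fin n) (Fin n) ℂ, Q ∈ Matrix.unitaryGroup (Fin n) ℂ ∧
        ∀ z : ℂ,
          P * Matrix.of ![z • a11 + z ^ 2 • a12, z • a21 + z ^ 2 • a22] * Q =
            Matrix.of (fun (i : Fin 2) (j : Fin n) =>
              if (j : ℕ) = (i : ℕ) then ((Real.sqrt 2 : ℝ) : ℂ) * z
              else if (j : ℕ) = (i : ℕ) + 2 then z ^ 2 else 0) := by
  obtain ⟨hc4, m1, m2, m3, n1, n2, n3, c1, c2, c3, c4⟩ := all_data a11 a21 a12 a22 c hA hB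
  have hs2 : ((Real.sqrt 2 : ℝ) : ℂ) * ((Real.sqrt 2 : ℝ) : ℂ) = 2 := by
    rw [← Complex.ofReal_mul, Real.mul_self_sqrt (by norm_num)]; norm_num
  have hs0 : ((Real.sqrt 2 : ℝ) : ℂ) ≠ 0 := by
    intro h; rw [h] at hs2; norm_num at hs2
  generalize hs : ((Real.sqrt 2 : ℝ) : ℂ) = s at hs2 hs0
  have hsc : (starRingEnd ℂ) s = s := by rw [← hs, conj_ofReal]
  have sw : ∀ u w : Fin n → ℂ, hinner u w = 0 → hinner w u = 0 := by
    intro u w h; rw [← hinner_conj, h, map_zero]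
  have hii : s⁻¹ * (s⁻¹ * 2) = 1 := by rw [← hs2]; field_simp
  obtain ⟨hn4, b, hbb, hb⟩ := extend ![s⁻¹ • a11, s⁻¹ • a21, a12, a22] (by
    intro i j
    fin_cases i <;> fin_cases j <;>
      simp [hinner_smul_left, hinner_smul_right, hsc, m1, m2, m3, n1, n2, n3, c1, c2, c3, c4,
        sw _ _ m3, sw _ _ n3, sw _ _ c1, sw _ _ c2, sw _ _ c3, sw _ _ c4, hii])
  refine ⟨hc4, hn4, 1, one_mem _, Matrix.of fun k j => (starRingEnd ℂ) (b j k), ?_, ?_⟩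
  · rw [Matrix.mem_unitaryGroup_iff']
    ext i j
    have := hbb i j
    simp only [hinner] at this
    simp [Matrix.mul_apply, Matrix.one_apply, Matrix.star_apply, this]
  · intro z
    have h0 : ∀ j, hinner a11 (b j) = if (j : ℕ) = 0 then s else 0 := by
      intro j
      have := hb 0 j
      simp [hinner_smul_left] at this
      rw [← mul_inv_cancel_left₀ hs0 (hinner a11 (b j)), this]; simp
    have h1 : ∀ j, hinner a21 (b j) = if (j : ℕ) = 1 then s else 0 := by
      intro j
      have := hb 1 j
      simp [hinner_smul_left] at this
      rw [← mul_inv_cancel_left₀ hs0 (hinner a21 (b j)), this]; simp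
    have h2 : ∀ j, hinner a12 (b j) = if (j : ℕ) = 2 then 1 else 0 := by
      intro j
      simpa using hb 2 j
    have h3 : ∀ j, hinner a22 (b j) = if (j : ℕ) = 3 then 1 else 0 := by
      intro j
      simpa using hb 3 j
    rw [Matrix.one_mul]
    ext i j
    have key : ∀ u : Fin 2 → Fin n → ℂ, (Matrix.of u * Matrix.of fun k j => (starRingEnd ℂ) (b j k)) i j
        = hinner (u i) (b j) := by
      intro u; simp [Matrix.mul_apply, hinner]
    rw [key]
    fin_cases i
    · simp [hinner_add_left, hinner_smul_left, h0, h2]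
      split_ifs <;> first | omega | ring
    · simp [hinner_add_left, hinner_smul_left, h1, h3]
      split_ifs <;> first | omega | ring
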